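/- For any finite connected graph G with at least 2 vertices, gpg'(G) = 2 if and only if G belongs to the family 𝓗. -/

import Mathlib

open Finset SimpleGraph

variable {V : Type*}

/-- `S` is in general position in `G`: no shortest path of `G` contains more than
two vertices of `S`. -/
def IsGPSet (G : SimpleGraph V) (S : Set V) : Prop :=
  ∀ ⦃u v : V⦄ (p : G.Walk u v), p.IsPath → p.length = G.dist u v →
    (S ∩ {x | x ∈ p.support}).ncard ≤ 2

open scoped Classical in
/-- The set of vertices that can legally be played when the set of already selected
vertices is `S`. -/
noncomputable def playable [Fintype V] (G : SimpleGraph V) (S : Finset V) : Finset V :=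
  Finset.univ.filter (fun v => v ∉ S ∧ IsGPSet G (↑(insert v S) : Set V))

open scoped Classical in
/-- Value (final set size with optimal play) of the Builder-Blocker general position game
from position `S` with the given player to move (`true` = Builder, the maximiser;
`false` = Blocker, the minimiser), computed with a fuel parameter. -/
noncomputable def gameValAux [Fintype V] (G : SimpleGraph V) : ℕ → Bool → Finset V → ℕ
  | 0, _, S => S.card
  | fuel + 1, turn, S =>
    if h : (playable G S).Nonempty then
      if turn then (playable G S).sup' h (fun v => gameValAux G fuel (!turn) (insert v S))
      else (playable G S).inf' h (fun v => gameValAux G fuel (!turn) (insert v S))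
    else S.card

/-- Value of the Builder-Blocker general position game from position `S`,
with `turn = true` meaning Builder (the maximiser) is to move. Since at most
`Fintype.card V - S.card` further moves are possible, this fuel suffices. -/
noncomputable def gameVal [Fintype V] (G : SimpleGraph V) (turn : Bool) (S : Finset V) : ℕ :=
  gameValAux G (Fintype.card V - S.card) turn S

/-- The B-game general position number: Builder moves first. -/
noncomputable def gpg [Fintype V] (G : SimpleGraph V) : ℕ := gameVal G true ∅

/-- The B'-game general position number: Blocker moves first. -/
noncomputable def gpg' [Fintype V] (G : SimpleGraph V) : ℕ := gameVal G false ∅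

/-- Base relation of the model graph for the family `𝓗`.
Vertices: the centre `u` (`Sum.inl`), for each `i ∈ Fin k` the `n i ≥ 2` middle
vertices of `K_{2,n_i}` (first `Sum.inr` summand), the vertex `u_i'` together with its
pendant path of length `p i` (second summand, `u_i'` being position `0`), and
for each `j ∈ Fin m` a pendant path at `u` of length `q j` (third summand). -/
def HRel (k m : ℕ) (n p : Fin k → ℕ) (q : Fin m → ℕ) :
    (Unit ⊕ (Σ i : Fin k, Fin (n i)) ⊕ (Σ i : Fin k, Fin (p i + 1)) ⊕ (Σ j : Fin m, Fin (q j))) →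
    (Unit ⊕ (Σ i : Fin k, Fin (n i)) ⊕ (Σ i : Fin k, Fin (p i + 1)) ⊕ (Σ j : Fin m, Fin (q j))) →
    Prop
  | Sum.inl _, Sum.inr (Sum.inl _) => True
  | Sum.inr (Sum.inl ⟨i, _⟩), Sum.inr (Sum.inr (Sum.inl ⟨i', t⟩)) => (i : ℕ) = i' ∧ (t : ℕ) = 0
  | Sum.inr (Sum.inr (Sum.inl ⟨i, t⟩)), Sum.inr (Sum.inr (Sum.inl ⟨i', t'⟩)) =>
      (i : ℕ) = i' ∧ (t' : ℕ) = (t : ℕ) + 1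
  | Sum.inl _, Sum.inr (Sum.inr (Sum.inr ⟨_, t⟩)) => (t : ℕ) = 0
  | Sum.inr (Sum.inr (Sum.inr ⟨j, t⟩)), Sum.inr (Sum.inr (Sum.inr ⟨j', t'⟩)) =>
      (j : ℕ) = j' ∧ (t' : ℕ) = (t : ℕ) + 1
  | _, _ => False

/-- The model graph of the family `𝓗`. -/
def HModel (k m : ℕ) (n p : Fin k → ℕ) (q : Fin m → ℕ) :
    SimpleGraph (Unit ⊕ (Σ i : Fin k, Fin (n i)) ⊕ (Σ i : Fin k, Fin (p i + 1)) ⊕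
      (Σ j : Fin m, Fin (q j))) :=
  SimpleGraph.fromRel (HRel k m n p q)

/-- Membership in the family `𝓗`: `G` arises from `k` complete bipartite graphs
`K_{2, n_i}` (`n_i ≥ 2`) with the degree-2 vertices `u_i` identified into a single vertex
`u`, a pendant path of arbitrary length attached at each `u_i'`, and arbitrarily many
pendant paths attached at `u`. -/
def InH {W : Type*} (G : SimpleGraph W) : Prop :=
  ∃ (k m : ℕ) (n p : Fin k → ℕ) (q : Fin m → ℕ),
    (∀ i, 2 ≤ n i) ∧ Nonempty (G ≃g HModel k m n p q)

theorem card_le_gameValAux [Fintype V] (G : SimpleGraph V) (fuel : ℕ) (turn : Bool)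
    (S : Finset V) : S.card ≤ gameValAux G fuel turn S := by
  classical
  induction fuel generalizing turn S with
  | zero => exact le_rfl
  | succ f ih =>
    have key : ∀ v ∈ playable G S, S.card ≤ gameValAux G f (!turn) (insert v S) := fun v _ =>
      (card_le_card (subset_insert v S)).trans (ih _ _)
    unfold gameValAux
    split_ifs with h ht
    · obtain ⟨v, hv⟩ := h
      refine (key v hv).trans ?_
      convert le_sup' (fun v => gameValAux G f (!turn) (insert v S)) hv
    · convert le_inf' h _ key
    · exact le_rfl

theorem card_lt_gameValAux [Fintype V] (G : SimpleGraph V) (fuel : ℕ) (turn : Bool)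
    (S : Finset V) (h : (playable G S).Nonempty) : S.card < gameValAux G (fuel + 1) turn S := by
  classical
  have key : ∀ v ∈ playable G S, S.card + 1 ≤ gameValAux G fuel (!turn) (insert v S) := by
    intro v hv
    have hvS : v ∉ S := (mem_filter.1 hv).2.1
    rw [← card_insert_of_notMem hvS]
    exact card_le_gameValAux _ _ _ _
  unfold gameValAux
  rw [dif_pos h]
  refine Nat.lt_of_succ_le ?_
  split_ifs
  · obtain ⟨v, hv⟩ := h
    refine (key v hv).trans ?_
    convert le_sup' (fun v => gameValAux G fuel (!turn) (insert v S)) hv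
  · convert le_inf' h _ key

open scoped Classical in
theorem gameValAux_false_le_iff [Fintype V] (G : SimpleGraph V) (fuel c : ℕ) (S : Finset V)
    (h : (playable G S).Nonempty) :
    gameValAux G (fuel + 1) false S ≤ c ↔
      ∃ v ∈ playable G S, gameValAux G fuel true (insert v S) ≤ c := by
  simp [gameValAux, h]

open scoped Classical in
theorem gameValAux_true_le_iff [Fintype V] (G : SimpleGraph V) (fuel c : ℕ) (S : Finset V)
    (h : (playable G S).Nonempty) :
    gameValAux G (fuel + 1) true S ≤ c ↔
      ∀ v ∈ playable G S, gameValAux G fuel false (insert v S) ≤ c := by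
  simp [gameValAux, h]

theorem gameValAux_eq_card [Fintype V] (G : SimpleGraph V) (fuel : ℕ) (turn : Bool)
    (S : Finset V) (h : playable G S = ∅) : gameValAux G fuel turn S = S.card := by
  cases fuel with
  | zero => rfl
  | succ f => unfold gameValAux; simp [h]

theorem isGPSet_of_ncard_le [Fintype V] (G : SimpleGraph V) {S : Set V} (hS : S.ncard ≤ 2) :
    IsGPSet G S := fun _ _ _ _ _ =>
  (Set.ncard_le_ncard Set.inter_subset_left (Set.toFinite S)).trans hS

open scoped Classical in
theorem mem_playable [Fintype V] {G : SimpleGraph V} {S : Finset V} {v : V} :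
    v ∈ playable G S ↔ v ∉ S ∧ IsGPSet G (insert v (S : Set V)) := by
  simp [playable]

open scoped Classical in
theorem gpg'_eq_two_iff_playable [Fintype V] (G : SimpleGraph V) (h2 : 2 ≤ Fintype.card V) :
    gpg' G = 2 ↔ ∃ u, ∀ v, v ≠ u → playable G {v, u} = ∅ := by
  obtain ⟨f, hf⟩ := Nat.exists_eq_add_of_le' h2
  have hp0 : playable G ∅ = Finset.univ := by
    ext v
    simp only [mem_playable, mem_univ, iff_true]
    exact ⟨by simp, isGPSet_of_ncard_le G (by simp)⟩
  have hp1 : ∀ u v, v ∈ playable G {u} ↔ v ≠ u := by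
    intro u v
    simp only [mem_playable, Finset.mem_singleton, and_iff_left_iff_imp]
    exact fun _ => isGPSet_of_ncard_le G (by simpa using Set.ncard_insert_le v {u})
  have hne0 : (Finset.univ : Finset V).Nonempty := by
    rw [← card_pos, card_univ]; omega
  have hne1 : ∀ u, (playable G {u}).Nonempty := by
    intro u
    obtain ⟨v, hv⟩ := Fintype.exists_ne_of_one_lt_card (by omega : 1 < Fintype.card V) u
    exact ⟨v, (hp1 u v).2 hv⟩
  have hval : ∀ u v, v ≠ u → (gameValAux G f false {v, u} ≤ 2 ↔ playable G {v, u} = ∅) := by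
    intro u v hvu
    have hc : ({v, u} : Finset V).card = 2 := card_pair hvu
    refine ⟨fun h => ?_, fun h => ?_⟩
    · by_contra hne
      obtain ⟨w, hw⟩ := nonempty_iff_ne_empty.2 hne
      have h3 : ({w, v, u} : Finset V).card = 3 := by
        rw [card_insert_of_notMem (mem_filter.1 hw).2.1, hc]
      have h4 := card_le_univ ({w, v, u} : Finset V)
      obtain ⟨g, rfl⟩ : ∃ g, f = g + 1 := ⟨f - 1, by omega⟩
      have := card_lt_gameValAux G g false {v, u} ⟨w, hw⟩
      omega
    · rw [gameValAux_eq_card _ _ _ _ h, hc]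
  have hgpg : gpg' G = gameValAux G (f + 2) false ∅ := by
    rw [gpg', gameVal, card_empty, hf, Nat.sub_zero]
  have hge : 2 ≤ gpg' G := by
    by_contra hlt
    rw [hgpg, not_le, Nat.lt_succ_iff, gameValAux_false_le_iff _ _ _ _ (hp0 ▸ hne0)] at hlt
    obtain ⟨u, -, hu⟩ := hlt
    have := card_lt_gameValAux G f true {u} (hne1 u)
    simp only [card_singleton, insert_empty_eq] at this hu
    omega
  have hle : gpg' G ≤ 2 ↔ ∃ u, ∀ v, v ≠ u → playable G {v, u} = ∅ := by
    rw [hgpg, gameValAux_false_le_iff _ _ _ _ (hp0 ▸ hne0)]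
    simp only [hp0, mem_univ, true_and, insert_empty_eq]
    refine exists_congr fun u => ?_
    rw [gameValAux_true_le_iff _ _ _ _ (hne1 u)]
    simp only [hp1]
    exact forall₂_congr fun v hv => hval u v hv
  rw [← hle]
  omega

theorem dist_getVert_of_geodesic {G : SimpleGraph V} {a b : V}
    (p : G.Walk a b) (hp : p.length = G.dist a b) {i j : ℕ} (hij : i ≤ j) (hj : j ≤ p.length) :
    G.dist (p.getVert i) (p.getVert j) = j - i := by
  have h := length_eq_dist_of_subwalk hp
    ((Walk.isSubwalk_drop (p.take j) i).trans (p.isSubwalk_take j))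
  rw [Walk.drop_length, Walk.take_length, min_eq_left hj, Walk.take_getVert, min_eq_right hij] at h
  exact h.symm

/-- Among `u`, `v`, `w` one vertex lies on a shortest path between the other two. -/
def Collinear3 (G : SimpleGraph V) (u v w : V) : Prop :=
  G.dist u v + G.dist v w = G.dist u w ∨ G.dist u w + G.dist v w = G.dist u v ∨
    G.dist u v + G.dist u w = G.dist v w

theorem isGPSet_triple_iff {G : SimpleGraph V} (hG : G.Connected) {u v w : V}
    (hvu : v ≠ u) (hwu : w ≠ u) (hwv : w ≠ v) :
    IsGPSet G {w, v, u} ↔ ¬ Collinear3 G u v w := by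
  have hcard : ({w, v, u} : Set V).ncard = 3 := by
    rw [Set.ncard_insert_of_notMem (by simp [hwu, hwv]), Set.ncard_pair hvu]
  have hext : ∀ {a b c : V}, ({a, b, c} : Set V) = {w, v, u} →
      G.dist a b + G.dist b c = G.dist a c → ¬ IsGPSet G {w, v, u} := by
    intro a b c hS h hgp
    obtain ⟨p, hp⟩ := hG.exists_walk_length_eq_dist a b
    obtain ⟨q, hq⟩ := hG.exists_walk_length_eq_dist b c
    have hl : (p.append q).length = G.dist a c := by rw [Walk.length_append, hp, hq, h]
    have := hgp (p.append q) ((p.append q).isPath_of_length_eq_dist hl) hl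
    rw [Set.inter_eq_left.2, hcard] at this
    · omega
    · rw [← hS]
      rintro x (rfl | rfl | rfl) <;> simp
  constructor
  · rintro hgp (h | h | h)
    · refine hext ?_ h hgp
      ext; simp; tauto
    · refine hext (a := u) (b := w) (c := v) ?_ (by rw [G.dist_comm (u := w)]; exact h) hgp
      ext; simp; tauto
    · refine hext (a := v) (b := u) (c := w) ?_ (by rw [G.dist_comm (u := v)]; exact h) hgp
      ext; simp; tauto
  · intro hcol a b p _ hl
    by_contra hlt
    refine hcol ?_
    have hsub : ({w, v, u} : Set V) ∩ {x | x ∈ p.support} = {w, v, u} :=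
      Set.eq_of_subset_of_ncard_le Set.inter_subset_left (by omega) (Set.toFinite _)
    rw [Set.inter_eq_left] at hsub
    obtain ⟨i, rfl, hi⟩ := Walk.mem_support_iff_exists_getVert.1 (hsub (show u ∈ _ by simp))
    obtain ⟨j, rfl, hj⟩ := Walk.mem_support_iff_exists_getVert.1 (hsub (show v ∈ _ by simp))
    obtain ⟨k, rfl, hk⟩ := Walk.mem_support_iff_exists_getVert.1 (hsub (show w ∈ _ by simp))
    have hd : ∀ i j, i ≤ p.length → j ≤ p.length →
        G.dist (p.getVert i) (p.getVert j) = max i j - min i j := by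
      intro i j hi hj
      rcases le_total i j with h | h
      · rw [dist_getVert_of_geodesic p hl h hj, max_eq_right h, min_eq_left h]
      · rw [G.dist_comm, dist_getVert_of_geodesic p hl h hi, max_eq_left h, min_eq_right h]
    unfold Collinear3
    rw [hd i j hi hj, hd j k hj hk, hd i k hi hk]
    omega

theorem gpg'_eq_two_iff [Fintype V] {G : SimpleGraph V} (hG : G.Connected)
    (h2 : 2 ≤ Fintype.card V) :
    gpg' G = 2 ↔ ∃ u, ∀ v w, v ≠ u → w ≠ u → w ≠ v → Collinear3 G u v w := by
  classical
  rw [gpg'_eq_two_iff_playable G h2]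
  refine exists_congr fun u => ⟨fun h v w hv hw hwv => ?_, fun h v hv => ?_⟩
  · by_contra hc
    have : w ∈ playable G {v, u} := by
      rw [mem_playable]
      refine ⟨by simp [hw, hwv], ?_⟩
      simpa using (isGPSet_triple_iff hG hv hw hwv).2 hc
    convert h v hv ▸ this
    simp
  · refine eq_empty_of_forall_notMem fun w hw => ?_
    rw [mem_playable] at hw
    obtain ⟨h1, h3⟩ := hw
    simp only [Finset.mem_insert, Finset.mem_singleton, not_or] at h1
    refine (isGPSet_triple_iff hG hv h1.2 h1.1).1 ?_ (h v w hv h1.2 h1.1)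
    simpa using h3

theorem dist_iso {W : Type*} {G : SimpleGraph V} {H : SimpleGraph W} (φ : G ≃g H)
    (hG : G.Connected) (hH : H.Connected) (a b : V) : H.dist (φ a) (φ b) = G.dist a b := by
  apply le_antisymm
  · obtain ⟨p, hp⟩ := hG.exists_walk_length_eq_dist a b
    rw [← hp, ← Walk.length_map φ.toHom p]
    exact dist_le _
  · obtain ⟨p, hp⟩ := hH.exists_walk_length_eq_dist (φ a) (φ b)
    rw [← hp, ← Walk.length_map φ.symm.toHom p]
    simpa using dist_le (p.map φ.symm.toHom)

theorem abs_sub_le_dist {G : SimpleGraph V} (hG : G.Connected) {f : V → ℤ}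
    (hf : ∀ a b, G.Adj a b → |f a - f b| ≤ 1) (a b : V) : |f a - f b| ≤ G.dist a b := by
  obtain ⟨p, hp⟩ := hG.exists_walk_length_eq_dist a b
  rw [← hp]
  clear hp
  induction p with
  | nil => simp
  | @cons a c b h p ih =>
    have h1 := hf _ _ h
    have h2 := abs_sub_le (f a) (f c) (f b)
    rw [Walk.length_cons]
    push_cast
    linarith

namespace HModel

/-- The vertices of the model graph. -/
abbrev Vert (k m : ℕ) (n p : Fin k → ℕ) (q : Fin m → ℕ) : Type :=
  Unit ⊕ (Σ i : Fin k, Fin (n i)) ⊕ (Σ i : Fin k, Fin (p i + 1)) ⊕ (Σ j : Fin m, Fin (q j))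

variable {k m : ℕ} {n p : Fin k → ℕ} {q : Fin m → ℕ}

/-- The centre `u`. -/
abbrev centre : Vert k m n p q := Sum.inl ()

/-- The middle vertices of the `K_{2, n_i}`. -/
abbrev mid (i : Fin k) (a : Fin (n i)) : Vert k m n p q := Sum.inr (Sum.inl ⟨i, a⟩)

/-- The vertices on the path starting at `u_i'`. -/
abbrev tail (i : Fin k) (t : Fin (p i + 1)) : Vert k m n p q := Sum.inr (Sum.inr (Sum.inl ⟨i, t⟩))

/-- The vertices on the pendant paths at `u`. -/
abbrev leg (j : Fin m) (t : Fin (q j)) : Vert k m n p q := Sum.inr (Sum.inr (Sum.inr ⟨j, t⟩))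

/-- The distance from the centre. -/
def level : Vert k m n p q → ℕ
  | Sum.inl _ => 0
  | Sum.inr (Sum.inl _) => 1
  | Sum.inr (Sum.inr (Sum.inl ⟨_, t⟩)) => t + 2
  | Sum.inr (Sum.inr (Sum.inr ⟨_, t⟩)) => t + 1

theorem level_centre : level (centre : Vert k m n p q) = 0 := rfl

/-- The branch at the centre containing a given vertex. -/
def branch : Vert k m n p q → Option (Fin k ⊕ Fin m)
  | Sum.inl _ => none
  | Sum.inr (Sum.inl ⟨i, _⟩) => some (Sum.inl i)
  | Sum.inr (Sum.inr (Sum.inl ⟨i, _⟩)) => some (Sum.inl i)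
  | Sum.inr (Sum.inr (Sum.inr ⟨j, _⟩)) => some (Sum.inr j)

theorem level_of_rel {a b : Vert k m n p q} (h : HRel k m n p q a b) :
    level b = level a + 1 := by
  rcases a with _ | ⟨i, a⟩ | ⟨i, t⟩ | ⟨j, t⟩ <;> rcases b with _ | ⟨i', a'⟩ | ⟨i', t'⟩ | ⟨j', t'⟩ <;>
    simp_all [HRel, level]

theorem branch_of_rel {a b : Vert k m n p q} (h : HRel k m n p q a b) :
    a = centre ∨ branch a = branch b := by
  rcases a with _ | ⟨i, a⟩ | ⟨i, t⟩ | ⟨j, t⟩ <;> rcases b with _ | ⟨i', a'⟩ | ⟨i', t'⟩ | ⟨j', t'⟩ <;>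
    simp only [HRel] at h <;> simp [branch]
  · exact Fin.ext h.1
  · exact Fin.ext h.1
  · exact Fin.ext h.1

theorem adj_of_rel {a b : Vert k m n p q} (h : HRel k m n p q a b) :
    (HModel k m n p q).Adj a b :=
  (fromRel_adj _ _ _).2 ⟨fun hab => by have := level_of_rel h; rw [hab] at this; omega, Or.inl h⟩

theorem level_le_dist (hH : (HModel k m n p q).Connected) (v w : Vert k m n p q) :
    level w ≤ level v + (HModel k m n p q).dist v w := by
  have := abs_sub_le_dist hH (f := fun x => (level x : ℤ)) (fun a b hab => by
    rcases ((fromRel_adj _ _ _).1 hab).2 with h | h <;> simp [level_of_rel h]) v w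
  rw [abs_le] at this
  omega

theorem level_add_level_le_dist (hH : (HModel k m n p q).Connected) {v w : Vert k m n p q}
    (hb : branch v ≠ branch w) : level v + level w ≤ (HModel k m n p q).dist v w := by
  have hlip : ∀ a b : Vert k m n p q, HRel k m n p q a b →
      |(if branch a = branch v then (level a : ℤ) else -level a) -
        (if branch b = branch v then (level b : ℤ) else -level b)| ≤ 1 := by
    intro a b h
    have hl := level_of_rel h
    rcases branch_of_rel h with rfl | hab
    · simp only [level] at hl ⊢
      rw [hl]
      split_ifs <;> simp
    · rw [hab, hl, abs_le]
      split_ifs <;> push_cast <;> constructor <;> linarith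
  have := abs_sub_le_dist hH
    (f := fun x => if branch x = branch v then (level x : ℤ) else -level x) (fun a b hab => by
      rcases ((fromRel_adj _ _ _).1 hab).2 with h | h
      · exact hlip a b h
      · rw [abs_sub_comm]
        exact hlip b a h) v w
  simp only [if_true, if_neg hb.symm, abs_le] at this
  omega

theorem dist_le_one_of_rel {a b : Vert k m n p q} (h : HRel k m n p q a b) :
    (HModel k m n p q).dist a b ≤ 1 :=
  (dist_eq_one_iff_adj.2 (adj_of_rel h)).le

theorem dist_tail_le (hH : (HModel k m n p q).Connected) (i : Fin k) (s d : ℕ)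
    (h : s + d < p i + 1) :
    (HModel k m n p q).dist (tail i ⟨s, by omega⟩) (tail i ⟨s + d, h⟩) ≤ d := by
  induction d with
  | zero => simp
  | succ d ih =>
    have h1 : (HModel k m n p q).dist (tail i ⟨s + d, by omega⟩) (tail i ⟨s + (d + 1), h⟩) ≤ 1 :=
      dist_le_one_of_rel (by simp [HRel]; omega)
    exact hH.dist_triangle.trans (add_le_add (ih (by omega)) h1)

theorem dist_leg_le (hH : (HModel k m n p q).Connected) (j : Fin m) (s d : ℕ)
    (h : s + d < q j) :
    (HModel k m n p q).dist (leg j ⟨s, by omega⟩) (leg j ⟨s + d, h⟩) ≤ d := by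
  induction d with
  | zero => simp
  | succ d ih =>
    have h1 : (HModel k m n p q).dist (leg j ⟨s + d, by omega⟩) (leg j ⟨s + (d + 1), h⟩) ≤ 1 :=
      dist_le_one_of_rel (by simp [HRel]; omega)
    exact hH.dist_triangle.trans (add_le_add (ih (by omega)) h1)

theorem dist_mid_tail_le (hH : (HModel k m n p q).Connected) (i : Fin k) (a : Fin (n i))
    (t : Fin (p i + 1)) : (HModel k m n p q).dist (mid i a) (tail i t) ≤ 1 + t := by
  refine (hH.dist_triangle (v := tail i 0)).trans (add_le_add ?_ ?_)
  · exact dist_le_one_of_rel (by simp [HRel])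
  · have := dist_tail_le hH i 0 t (by omega)
    simpa using this

theorem dist_centre_le (hH : (HModel k m n p q).Connected) (hn : ∀ i, 2 ≤ n i)
    (v : Vert k m n p q) : (HModel k m n p q).dist centre v ≤ level v := by
  have hmid : ∀ i a, (HModel k m n p q).dist centre (mid i a) ≤ 1 := fun i a =>
    dist_le_one_of_rel (by simp [HRel])
  rcases v with _ | ⟨i, a⟩ | ⟨i, t⟩ | ⟨j, t⟩
  · simp
  · exact hmid i a
  · have := dist_mid_tail_le hH i ⟨0, by have := hn i; omega⟩ t
    refine (hH.dist_triangle (v := mid i ⟨0, by have := hn i; omega⟩)).trans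
      ((add_le_add (hmid _ _) this).trans ?_)
    simp only [level]
    omega
  · have h1 : (HModel k m n p q).dist centre (leg j ⟨0, t.pos⟩) ≤ 1 :=
      dist_le_one_of_rel (by simp [HRel])
    have h2 := dist_leg_le hH j 0 t (by have := t.2; omega)
    simp only [Nat.zero_add, Fin.eta] at h2
    refine (hH.dist_triangle (v := leg j ⟨0, t.pos⟩)).trans ((add_le_add h1 h2).trans ?_)
    simp only [level]
    omega

theorem collinear3_of_dist_le (hH : (HModel k m n p q).Connected) (hn : ∀ i, 2 ≤ n i)
    {v w : Vert k m n p q} (h : (HModel k m n p q).dist v w + level v ≤ level w) :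
    Collinear3 (HModel k m n p q) centre v w := by
  have h1 := dist_centre_le hH hn v
  have h2 := level_le_dist hH centre w
  have h3 := hH.dist_triangle (u := centre) (v := v) (w := w)
  rw [level_centre] at h2
  left
  omega

theorem collinear3_of_le_dist (hH : (HModel k m n p q).Connected) (hn : ∀ i, 2 ≤ n i)
    {v w : Vert k m n p q} (h : level v + level w ≤ (HModel k m n p q).dist v w) :
    Collinear3 (HModel k m n p q) centre v w := by
  have h1 := dist_centre_le hH hn v
  have h2 := dist_centre_le hH hn w
  have h3 := hH.dist_triangle (u := v) (v := centre) (w := w)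
  rw [dist_comm (u := v) (v := centre)] at h3
  right; right
  omega

end HModel

theorem Collinear3.swap {G : SimpleGraph V} {u v w : V} (h : Collinear3 G u v w) :
    Collinear3 G u w v := by
  unfold Collinear3 at *
  rw [G.dist_comm (u := w) (v := v)]
  omega

namespace HModel

variable {k m : ℕ} {n p : Fin k → ℕ} {q : Fin m → ℕ}

theorem collinear3_centre (hH : (HModel k m n p q).Connected) (hn : ∀ i, 2 ≤ n i)
    {v w : Vert k m n p q} (hv : v ≠ centre) (hw : w ≠ centre) (hwv : w ≠ v) :
    Collinear3 (HModel k m n p q) centre v w := by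
  by_cases hb : branch v = branch w
  swap
  · exact collinear3_of_le_dist hH hn (level_add_level_le_dist hH hb)
  have htail : ∀ i (s t : Fin (p i + 1)), s ≤ t →
      Collinear3 (HModel k m n p q) centre (tail i s) (tail i t) := by
    intro i s t hst
    obtain ⟨d, hd⟩ := Nat.exists_eq_add_of_le (Fin.le_def.1 hst)
    have h := dist_tail_le hH i s d (by omega)
    simp only [← hd, Fin.eta] at h
    exact collinear3_of_dist_le hH hn (by simp only [level]; omega)
  have hleg : ∀ j (s t : Fin (q j)), s ≤ t →
      Collinear3 (HModel k m n p q) centre (leg j s) (leg j t) := by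
    intro i s t hst
    obtain ⟨d, hd⟩ := Nat.exists_eq_add_of_le (Fin.le_def.1 hst)
    have h := dist_leg_le hH i s d (by omega)
    simp only [← hd, Fin.eta] at h
    exact collinear3_of_dist_le hH hn (by simp only [level]; omega)
  have hmt : ∀ i a t, Collinear3 (HModel k m n p q) centre (mid i a) (tail i t) := fun i a t =>
    collinear3_of_dist_le hH hn (by
      have := dist_mid_tail_le hH i a t
      simp only [level]
      omega)
  rcases v with _ | ⟨i, a⟩ | ⟨i, t⟩ | ⟨j, t⟩ <;> rcases w with _ | ⟨i', a'⟩ | ⟨i', t'⟩ | ⟨j', t'⟩ <;>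
    simp only [branch, Option.some.injEq, Sum.inl.injEq, Sum.inr.injEq, reduceCtorEq, ne_eq,
      not_true_eq_false] at hb hv hw
  · subst hb
    refine collinear3_of_le_dist hH hn ?_
    refine hH.one_lt_dist_of_ne_of_not_adj hwv.symm ?_
    simp [HModel, HRel]
  · subst hb
    exact hmt _ _ _
  · subst hb
    exact (hmt _ _ _).swap
  · subst hb
    rcases le_total t t' with h | h
    · exact htail _ _ _ h
    · exact (htail _ _ _ h).swap
  · subst hb
    rcases le_total t t' with h | h
    · exact hleg _ _ _ h
    · exact (hleg _ _ _ h).swap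

end HModel

theorem InH.exists_collinear3 {G : SimpleGraph V} (hG : G.Connected) (h : InH G) :
    ∃ u, ∀ v w, v ≠ u → w ≠ u → w ≠ v → Collinear3 G u v w := by
  obtain ⟨k, m, n, p, q, hn, ⟨φ⟩⟩ := h
  have hH : (HModel k m n p q).Connected := φ.connected_iff.1 hG
  refine ⟨φ.symm HModel.centre, fun v w hv hw hwv => ?_⟩
  have hv' : φ v ≠ HModel.centre := fun h => hv (by rw [← h, φ.symm_apply_apply])
  have hw' : φ w ≠ HModel.centre := fun h => hw (by rw [← h, φ.symm_apply_apply])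
  have h := HModel.collinear3_centre hH hn hv' hw' (φ.injective.ne hwv)
  rw [← φ.apply_symm_apply HModel.centre] at h
  simpa only [Collinear3, dist_iso φ hG hH] using h

theorem exists_dist_eq_of_le {G : SimpleGraph V} (hG : G.Connected) {a b : V} {t : ℕ}
    (ht : t ≤ G.dist a b) : ∃ c, G.dist a c = t ∧ t + G.dist c b = G.dist a b := by
  obtain ⟨p, hp⟩ := hG.exists_walk_length_eq_dist a b
  have h1 := dist_getVert_of_geodesic p hp (Nat.zero_le t) (by omega)
  have h2 := dist_getVert_of_geodesic p hp (i := t) (j := p.length) (by omega) le_rfl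
  rw [Walk.getVert_zero] at h1
  rw [Walk.getVert_length] at h2
  exact ⟨p.getVert t, by omega, by omega⟩

/-- `r` lies on a shortest path from `u` to `w`. -/
def Below (G : SimpleGraph V) (u r w : V) : Prop :=
  G.dist u r + G.dist r w = G.dist u w

namespace Below

variable {G : SimpleGraph V} {u r w z z' : V}

theorem refl (G : SimpleGraph V) (u r : V) : Below G u r r := by simp [Below]

theorem of_adj (h : G.Adj r w) (hl : G.dist u w = G.dist u r + 1) : Below G u r w := by
  rw [Below, dist_eq_one_iff_adj.2 h, hl]

theorem adj (h : Below G u r w) (hl : G.dist u w = G.dist u r + 1) : G.Adj r w := by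
  rw [← dist_eq_one_iff_adj]
  unfold Below at h
  omega

theorem trans (hG : G.Connected) (h1 : Below G u z r) (h2 : Below G u r w) : Below G u z w := by
  have h3 := hG.dist_triangle (u := z) (v := r) (w := w)
  have h4 := hG.dist_triangle (u := u) (v := z) (w := w)
  unfold Below at *
  omega

theorem exists_between (hG : G.Connected) (h : Below G u r w) {t : ℕ} (ht : t ≤ G.dist r w) :
    ∃ c, Below G u r c ∧ Below G u c w ∧ G.dist r c = t := by
  obtain ⟨c, h1, h2⟩ := exists_dist_eq_of_le hG ht
  have h3 := hG.dist_triangle (u := u) (v := r) (w := c)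
  have h4 := hG.dist_triangle (u := u) (v := c) (w := w)
  refine ⟨c, ?_, ?_, h1⟩ <;> unfold Below at * <;> omega

end Below

/-- Distinct vertices at the same distance from `u` have `u` on a shortest path between them. -/
theorem dist_of_dist_eq {G : SimpleGraph V} (hG : G.Connected) {u : V}
    (hC : ∀ v w, v ≠ u → w ≠ u → w ≠ v → Collinear3 G u v w) {v w : V} (hvw : v ≠ w)
    (hl : G.dist u v = G.dist u w) : G.dist v w = 2 * G.dist u v := by
  have hpos := hG.pos_dist_of_ne hvw
  have hu : ∀ x, G.dist u x = 0 → x = u := fun x hx => (hG.dist_eq_zero_iff.1 hx).symm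
  by_cases hv : v = u
  · subst hv
    exact absurd (hu w (by simpa using hl.symm)).symm hvw
  by_cases hw : w = u
  · subst hw
    exact absurd (hu v (by simpa using hl)) hvw
  rcases hC v w hv hw hvw.symm with h | h | h <;> omega

section Structure

variable {G : SimpleGraph V} {u : V}

/-- The vertex `u` is on a shortest path between any two distinct vertices equidistant from it. -/
def IsHub (G : SimpleGraph V) (u : V) : Prop :=
  ∀ ⦃v w⦄, v ≠ w → G.dist u v = G.dist u w → G.dist v w = 2 * G.dist u v

theorem IsHub.adj_level (hG : G.Connected) (hu : IsHub G u) {v w : V} (h : G.Adj v w) :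
    G.dist u w = G.dist u v + 1 ∨ G.dist u v = G.dist u w + 1 := by
  have h1 := dist_eq_one_iff_adj.2 h
  have h2 := hG.dist_triangle (u := u) (v := v) (w := w)
  have h3 := hG.dist_triangle (u := u) (v := w) (w := v)
  rw [G.dist_comm (u := w)] at h3
  by_contra hne
  have := hu h.ne (by omega)
  omega

theorem IsHub.above_unique (hG : G.Connected) (hu : IsHub G u) {r w w' : V}
    (hr : 0 < G.dist u r) (h : Below G u r w) (h' : Below G u r w')
    (hl : G.dist u w = G.dist u w') : w = w' := by
  by_contra hne
  have h1 := hu hne hl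
  have h2 := hG.dist_triangle (u := w) (v := r) (w := w')
  rw [G.dist_comm (u := w) (v := r)] at h2
  unfold Below at *
  omega

theorem IsHub.below_unique (hG : G.Connected) (hu : IsHub G u) {z z' w : V}
    (hz : G.dist u z = 2) (hz' : G.dist u z' = 2) (h : Below G u z w) (h' : Below G u z' w) :
    z = z' := by
  obtain ⟨d, hd⟩ : ∃ d, G.dist z w = d := ⟨_, rfl⟩
  induction d generalizing w with
  | zero =>
    have hd' : G.dist z' w = 0 := by unfold Below at *; omega
    rw [hG.dist_eq_zero_iff.1 hd, hG.dist_eq_zero_iff.1 hd']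
  | succ d ih =>
    have hd' : G.dist z' w = d + 1 := by unfold Below at *; omega
    obtain ⟨c, h1, h2, h3⟩ := h.exists_between hG (t := d) (by omega)
    obtain ⟨c', h1', h2', h3'⟩ := h'.exists_between hG (t := d) (by omega)
    have hcc : c = c' := by
      by_contra hne
      have hl : G.dist u c = G.dist u c' := by unfold Below at *; omega
      have h4 := hu hne hl
      have h5 := hG.dist_triangle (u := c) (v := w) (w := c')
      rw [G.dist_comm (u := w) (v := c')] at h5
      unfold Below at *
      omega
    exact ih h1 (hcc ▸ h1') h3

theorem IsHub.exists_chain [Fintype V] (hG : G.Connected) (hu : IsHub G u) {r : V}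
    (hr : 0 < G.dist u r) :
    ∃ (h : ℕ) (c : ℕ → V), c 0 = r ∧ (∀ t ≤ h, Below G u r (c t) ∧ G.dist r (c t) = t) ∧
      (∀ w, Below G u r w → ∃ t ≤ h, c t = w) ∧ ∀ t, t + 1 ≤ h → G.Adj (c t) (c (t + 1)) := by
  classical
  obtain ⟨m, hm, hmax⟩ := exists_max_image (univ.filter (Below G u r)) (G.dist r)
    ⟨r, by simpa using Below.refl G u r⟩
  simp only [mem_filter, mem_univ, true_and] at hm hmax
  have hex : ∀ t, ∃ c, t ≤ G.dist r m → Below G u r c ∧ G.dist r c = t := by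
    intro t
    by_cases ht : t ≤ G.dist r m
    · obtain ⟨c, h1, -, h2⟩ := hm.exists_between hG ht
      exact ⟨c, fun _ => ⟨h1, h2⟩⟩
    · exact ⟨r, fun h => absurd h ht⟩
  choose c hc using hex
  have hmem : ∀ w t, Below G u r w → G.dist r w = t → t ≤ G.dist r m → c t = w := by
    intro w t hw ht htm
    obtain ⟨h1, h2⟩ := hc t htm
    exact hu.above_unique hG hr h1 hw (by unfold Below at *; omega)
  refine ⟨G.dist r m, c, hmem r 0 (Below.refl G u r) (by simp) (Nat.zero_le _), hc,
    fun w hw => ⟨_, hmax w hw, hmem w _ hw rfl (hmax w hw)⟩, fun t ht => ?_⟩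
  obtain ⟨h1, h2⟩ := hc (t + 1) ht
  obtain ⟨d, h3, h4, h5⟩ := h1.exists_between hG (t := t) (by omega)
  rw [hmem d t h3 h5 (by omega)]
  exact h4.adj (by unfold Below at *; omega)

end Structure

/-- A vertex at distance two from `u` with at least two common neighbours with `u`. -/
def IsApex (G : SimpleGraph V) (u z : V) : Prop :=
  G.dist u z = 2 ∧ ∃ x y, x ≠ y ∧ G.dist u x = 1 ∧ G.dist u y = 1 ∧ G.Adj x z ∧ G.Adj y z

/-- A neighbour of `u` not adjacent to any apex. -/
def IsLegStart (G : SimpleGraph V) (u x : V) : Prop :=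
  G.dist u x = 1 ∧ ∀ z, IsApex G u z → ¬ G.Adj x z

section Structure

variable {G : SimpleGraph V} {u : V}

theorem IsHub.not_below_apex_of_below_legStart (hG : G.Connected) (hu : IsHub G u) {x z w : V}
    (hx : IsLegStart G u x) (hz : IsApex G u z) (hxw : Below G u x w) : ¬ Below G u z w := by
  intro hzw
  obtain ⟨y, h1, h2, h3⟩ := hxw.exists_between hG (t := 1) (by
    have := hx.1; have := hz.1; unfold Below at *; omega)
  have hy : G.dist u y = 2 := by have := hx.1; unfold Below at *; omega
  rw [hu.below_unique hG hy hz.1 h2 hzw] at h3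
  exact hx.2 z hz (dist_eq_one_iff_adj.1 h3)

theorem IsHub.legStart_below_unique (hG : G.Connected) (hu : IsHub G u) {x x' w : V}
    (hx : IsLegStart G u x) (hx' : IsLegStart G u x') (h : Below G u x w)
    (h' : Below G u x' w) : x = x' := by
  have hx1 := hx.1
  have hx1' := hx'.1
  by_cases hw : G.dist u w = 1
  · have h0 : G.dist x w = 0 := by unfold Below at *; omega
    have h0' : G.dist x' w = 0 := by unfold Below at *; omega
    rw [hG.dist_eq_zero_iff.1 h0, hG.dist_eq_zero_iff.1 h0']
  · obtain ⟨y, h1, h2, h3⟩ := h.exists_between hG (t := 1) (by unfold Below at *; omega)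
    obtain ⟨y', h1', h2', h3'⟩ := h'.exists_between hG (t := 1) (by unfold Below at *; omega)
    have hy : G.dist u y = 2 := by unfold Below at *; omega
    have hy' : G.dist u y' = 2 := by unfold Below at *; omega
    obtain rfl := hu.below_unique hG hy hy' h2 h2'
    rw [dist_eq_one_iff_adj] at h3 h3'
    by_contra hne
    exact hx.2 y ⟨hy, x, x', hne, hx1, hx1', h3, h3'⟩ h3

theorem IsHub.below_apex_of_two_le (hG : G.Connected) (hu : IsHub G u) {x z w : V}
    (hx : G.dist u x = 1) (hz : G.dist u z = 2) (hxz : G.Adj x z) (hxw : Below G u x w)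
    (hw : 2 ≤ G.dist u w) : Below G u z w := by
  obtain ⟨y, h1, h2, h3⟩ := hxw.exists_between hG (t := 1) (by unfold Below at *; omega)
  have hxz' : Below G u x z := .of_adj hxz (by rw [hx, hz])
  rwa [hu.above_unique hG (by omega) hxz' h1 (by unfold Below at *; omega)]

/-- Coordinates around `u`: the apices `z i`, their neighbours `M i` next to `u`, the starts `x j`
of the legs, and the chains `T i`, `L j` of vertices above `z i` and `x j`. -/
structure Branching (G : SimpleGraph V) (u : V) (k m : ℕ) (n p : Fin k → ℕ) (q : Fin m → ℕ) where
  z : Fin k → V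
  x : Fin m → V
  M : ∀ i, Fin (n i) → V
  T : Fin k → ℕ → V
  L : Fin m → ℕ → V
  apex : ∀ i, IsApex G u (z i)
  legStart : ∀ j, IsLegStart G u (x j)
  z_inj : ∀ i i', z i = z i' → i = i'
  x_inj : ∀ j j', x j = x j' → j = j'
  z_surj : ∀ v, IsApex G u v → ∃ i, z i = v
  x_surj : ∀ v, IsLegStart G u v → ∃ j, x j = v
  M_dist : ∀ i a, G.dist u (M i a) = 1
  M_adj : ∀ i a, G.Adj (M i a) (z i)
  M_inj : ∀ i a a', M i a = M i a' → a = a'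
  M_surj : ∀ i v, G.dist u v = 1 → G.Adj v (z i) → ∃ a, M i a = v
  T_zero : ∀ i, T i 0 = z i
  T_below : ∀ i, ∀ t < p i + 1, Below G u (z i) (T i t)
  T_dist : ∀ i, ∀ t < p i + 1, G.dist u (T i t) = t + 2
  T_surj : ∀ i v, Below G u (z i) v → ∃ t < p i + 1, T i t = v
  T_adj : ∀ i t, t + 1 < p i + 1 → G.Adj (T i t) (T i (t + 1))
  L_zero : ∀ j, L j 0 = x j
  L_below : ∀ j, ∀ t < q j, Below G u (x j) (L j t)
  L_dist : ∀ j, ∀ t < q j, G.dist u (L j t) = t + 1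
  L_surj : ∀ j v, Below G u (x j) v → ∃ t < q j, L j t = v
  L_adj : ∀ j t, t + 1 < q j → G.Adj (L j t) (L j (t + 1))

namespace Branching

variable {k m : ℕ} {n p : Fin k → ℕ} {q : Fin m → ℕ}

/-- The map from the model graph given by a system of coordinates. -/
def toFun (B : Branching G u k m n p q) : HModel.Vert k m n p q → V
  | Sum.inl _ => u
  | Sum.inr (Sum.inl ⟨i, a⟩) => B.M i a
  | Sum.inr (Sum.inr (Sum.inl ⟨i, t⟩)) => B.T i t
  | Sum.inr (Sum.inr (Sum.inr ⟨j, t⟩)) => B.L j t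

variable (B : Branching G u k m n p q)

theorem dist_toFun (a : HModel.Vert k m n p q) : G.dist u (B.toFun a) = HModel.level a := by
  rcases a with _ | ⟨i, a⟩ | ⟨i, t⟩ | ⟨j, t⟩
  · exact dist_self
  · exact B.M_dist i a
  · exact B.T_dist i t t.2
  · exact B.L_dist j t t.2

theorem z_unique (hG : G.Connected) (hu : IsHub G u) {i i' : Fin k} {w : V}
    (h : Below G u (B.z i) w) (h' : Below G u (B.z i') w) : i = i' :=
  B.z_inj _ _ (hu.below_unique hG (B.apex i).1 (B.apex i').1 h h')

theorem x_unique (hG : G.Connected) (hu : IsHub G u) {j j' : Fin m} {w : V}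
    (h : Below G u (B.x j) w) (h' : Below G u (B.x j') w) : j = j' :=
  B.x_inj _ _ (hu.legStart_below_unique hG (B.legStart j) (B.legStart j') h h')

theorem not_below_z_of_below_x (hG : G.Connected) (hu : IsHub G u) {i : Fin k} {j : Fin m}
    {w : V} (h : Below G u (B.x j) w) : ¬ Below G u (B.z i) w :=
  hu.not_below_apex_of_below_legStart hG (B.legStart j) (B.apex i) h

theorem eq_of_below_M_of_below_z (hG : G.Connected) (hu : IsHub G u) {i i' : Fin k}
    {a : Fin (n i)} {w : V} (h : Below G u (B.M i a) w) (h' : Below G u (B.z i') w) : i = i' := by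
  have hw : 2 ≤ G.dist u w := by
    have := (B.apex i').1
    unfold Below at h'
    omega
  exact B.z_unique hG hu (hu.below_apex_of_two_le hG (B.M_dist i a) (B.apex i).1 (B.M_adj i a)
    h hw) h'

theorem not_below_x_of_below_M (hG : G.Connected) (hu : IsHub G u) {i : Fin k} {j : Fin m}
    {a : Fin (n i)} {w : V} (h : Below G u (B.M i a) w) : ¬ Below G u (B.x j) w := by
  intro h'
  have hM := B.M_dist i a
  have hx := (B.legStart j).1
  by_cases hw : 2 ≤ G.dist u w
  · exact B.not_below_z_of_below_x hG hu h'
      (hu.below_apex_of_two_le hG hM (B.apex i).1 (B.M_adj i a) h hw)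
  · have h0 : G.dist (B.M i a) w = 0 := by unfold Below at *; omega
    have h0' : G.dist (B.x j) w = 0 := by unfold Below at *; omega
    rw [hG.dist_eq_zero_iff] at h0 h0'
    exact (B.legStart j).2 _ (B.apex i) (h0'.trans h0.symm ▸ B.M_adj i a)

theorem adj_of_rel {a b : HModel.Vert k m n p q} (h : HRel k m n p q a b) :
    G.Adj (B.toFun a) (B.toFun b) := by
  rcases a with _ | ⟨i, a⟩ | ⟨i, t⟩ | ⟨j, t⟩ <;> rcases b with _ | ⟨i', a'⟩ | ⟨i', t'⟩ | ⟨j', t'⟩ <;>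
    simp only [HRel] at h <;> simp only [toFun]
  · exact dist_eq_one_iff_adj.1 (B.M_dist i' a')
  · rw [h, B.L_zero]
    exact dist_eq_one_iff_adj.1 (B.legStart j').1
  · obtain ⟨h1, h2⟩ := h
    obtain rfl := Fin.ext h1
    rw [h2, B.T_zero]
    exact B.M_adj i a
  · obtain ⟨h1, h2⟩ := h
    obtain rfl := Fin.ext h1
    rw [h2]
    exact B.T_adj i t (by omega)
  · obtain ⟨h1, h2⟩ := h
    obtain rfl := Fin.ext h1
    rw [h2]
    exact B.L_adj j t (by omega)

theorem rel_of_adj (hG : G.Connected) (hu : IsHub G u) {a b : HModel.Vert k m n p q}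
    (h : G.Adj (B.toFun a) (B.toFun b)) (hl : HModel.level b = HModel.level a + 1) :
    HRel k m n p q a b := by
  have hb : Below G u (B.toFun a) (B.toFun b) :=
    .of_adj h (by rw [dist_toFun, dist_toFun, hl])
  rcases a with _ | ⟨i, a⟩ | ⟨i, t⟩ | ⟨j, t⟩ <;> rcases b with _ | ⟨i', a'⟩ | ⟨i', t'⟩ | ⟨j', t'⟩ <;>
    simp only [HModel.level] at hl <;> simp only [HRel] <;> simp only [toFun] at hb <;> try omega
  · have := B.eq_of_below_M_of_below_z hG hu hb (B.T_below i' t' t'.2)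
    exact ⟨congrArg _ this, by omega⟩
  · exact B.not_below_x_of_below_M hG hu hb (B.L_below j' t' t'.2)
  · have := B.z_unique hG hu ((B.T_below i t t.2).trans hG hb) (B.T_below i' t' t'.2)
    exact ⟨congrArg _ this, by omega⟩
  · exact B.not_below_z_of_below_x hG hu (B.L_below j' t' t'.2) ((B.T_below i t t.2).trans hG hb)
  · exact B.not_below_z_of_below_x hG hu ((B.L_below j t t.2).trans hG hb) (B.T_below i' t' t'.2)
  · have := B.x_unique hG hu ((B.L_below j t t.2).trans hG hb) (B.L_below j' t' t'.2)
    exact ⟨congrArg _ this, by omega⟩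

theorem toFun_injective (hG : G.Connected) (hu : IsHub G u) : Function.Injective B.toFun := by
  intro a b h
  have hl : HModel.level a = HModel.level b := by rw [← B.dist_toFun, ← B.dist_toFun, h]
  have hb : Below G u (B.toFun a) (B.toFun b) := h ▸ Below.refl G u _
  have hb' : Below G u (B.toFun b) (B.toFun a) := h ▸ Below.refl G u _
  rcases a with _ | ⟨i, a⟩ | ⟨i, t⟩ | ⟨j, t⟩ <;> rcases b with _ | ⟨i', a'⟩ | ⟨i', t'⟩ | ⟨j', t'⟩ <;>
    simp only [HModel.level] at hl <;> simp only [toFun] at h hb hb' <;> try omega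
  · rfl
  · have hz : Below G u (B.M i' a') (B.z i') :=
      .of_adj (B.M_adj i' a') (by rw [(B.apex i').1, B.M_dist])
    obtain rfl := B.eq_of_below_M_of_below_z hG hu (hb.trans hG hz) (Below.refl G u _)
    rw [B.M_inj _ _ _ h]
  · exact absurd (B.L_below j' t' t'.2) (B.not_below_x_of_below_M hG hu hb)
  · obtain rfl := B.z_unique hG hu ((B.T_below i t t.2).trans hG hb) (B.T_below i' t' t'.2)
    rw [Fin.ext (by omega : (t : ℕ) = t')]
  · exact absurd ((B.T_below i t t.2).trans hG hb)
      (B.not_below_z_of_below_x hG hu (B.L_below j' t' t'.2))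
  · exact absurd (B.L_below j t t.2) (B.not_below_x_of_below_M hG hu hb')
  · exact absurd (B.T_below i' t' t'.2)
      (B.not_below_z_of_below_x hG hu ((B.L_below j t t.2).trans hG hb))
  · obtain rfl := B.x_unique hG hu ((B.L_below j t t.2).trans hG hb) (B.L_below j' t' t'.2)
    rw [Fin.ext (by omega : (t : ℕ) = t')]

theorem toFun_surjective (hG : G.Connected) (hu : IsHub G u) : Function.Surjective B.toFun := by
  intro w
  by_cases hw0 : G.dist u w = 0
  · exact ⟨HModel.centre, hG.dist_eq_zero_iff.1 hw0⟩
  obtain ⟨x, hx, hxw⟩ := exists_dist_eq_of_le hG (Nat.one_le_iff_ne_zero.2 hw0)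
  replace hxw : Below G u x w := by unfold Below; omega
  by_cases hxl : IsLegStart G u x
  · obtain ⟨j, rfl⟩ := B.x_surj x hxl
    obtain ⟨t, ht, rfl⟩ := B.L_surj j w hxw
    exact ⟨HModel.leg j ⟨t, ht⟩, rfl⟩
  · simp only [IsLegStart, hx, true_and, not_forall, not_not] at hxl
    obtain ⟨z, hz, hxz⟩ := hxl
    obtain ⟨i, rfl⟩ := B.z_surj z hz
    by_cases hw : 2 ≤ G.dist u w
    · obtain ⟨t, ht, rfl⟩ := B.T_surj i w (hu.below_apex_of_two_le hG hx hz.1 hxz hxw hw)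
      exact ⟨HModel.tail i ⟨t, ht⟩, rfl⟩
    · have h0 : G.dist x w = 0 := by unfold Below at hxw; omega
      obtain rfl := hG.dist_eq_zero_iff.1 h0
      obtain ⟨a, rfl⟩ := B.M_surj i x hx hxz
      exact ⟨HModel.mid i a, rfl⟩

theorem nonempty_iso (B : Branching G u k m n p q) (hG : G.Connected) (hu : IsHub G u) :
    Nonempty (G ≃g HModel k m n p q) := by
  refine ⟨RelIso.symm ⟨Equiv.ofBijective B.toFun
    ⟨B.toFun_injective hG hu, B.toFun_surjective hG hu⟩, fun {a b} => ?_⟩⟩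
  change G.Adj (B.toFun a) (B.toFun b) ↔ _
  constructor
  · intro h
    rcases hu.adj_level hG h with hl | hl <;> rw [dist_toFun, dist_toFun] at hl
    · exact HModel.adj_of_rel (B.rel_of_adj hG hu h hl)
    · exact (HModel.adj_of_rel (B.rel_of_adj hG hu h.symm hl)).symm
  · intro h
    rcases ((fromRel_adj _ _ _).1 h).2 with h | h
    · exact B.adj_of_rel h
    · exact (B.adj_of_rel h).symm

end Branching

theorem IsHub.inH [Fintype V] (hG : G.Connected) (hu : IsHub G u) : InH G := by
  classical
  let N : V → Type _ := fun z => {x // G.dist u x = 1 ∧ G.Adj x z}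
  let eI := (Fintype.equivFin {z // IsApex G u z}).symm
  let eJ := (Fintype.equivFin {x // IsLegStart G u x}).symm
  let eN : ∀ z, Fin (Fintype.card (N z)) ≃ N z := fun z => (Fintype.equivFin (N z)).symm
  have hch : ∀ r, ∃ (h : ℕ) (c : ℕ → V), 0 < G.dist u r → c 0 = r ∧
      (∀ t ≤ h, Below G u r (c t) ∧ G.dist r (c t) = t) ∧
      (∀ w, Below G u r w → ∃ t ≤ h, c t = w) ∧ ∀ t, t + 1 ≤ h → G.Adj (c t) (c (t + 1)) := by
    intro r
    by_cases hr : 0 < G.dist u r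
    · obtain ⟨h, c, hc⟩ := hu.exists_chain hG hr
      exact ⟨h, c, fun _ => hc⟩
    · exact ⟨0, fun _ => r, fun h => absurd h hr⟩
  choose len c hc using hch
  have hcT := fun i => hc (eI i).1 (by rw [(eI i).2.1]; omega)
  have hcL := fun j => hc (eJ j).1 (by rw [(eJ j).2.1]; omega)
  refine ⟨_, _, fun i => Fintype.card (N (eI i).1), fun i => len (eI i).1,
    fun j => len (eJ j).1 + 1, fun i => ?_, Branching.nonempty_iso (u := u) ?_ hG hu⟩
  · obtain ⟨-, x, y, hxy, hx, hy, hxz, hyz⟩ := (eI i).2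
    exact Fintype.one_lt_card_iff.2 ⟨⟨x, hx, hxz⟩, ⟨y, hy, hyz⟩, fun h => hxy (congrArg (·.1) h)⟩
  · exact {
      z := fun i => (eI i).1
      x := fun j => (eJ j).1
      M := fun i a => (eN (eI i).1 a).1
      T := fun i => c (eI i).1
      L := fun j => c (eJ j).1
      apex := fun i => (eI i).2
      legStart := fun j => (eJ j).2
      z_inj := fun i i' h => eI.injective (Subtype.ext h)
      x_inj := fun j j' h => eJ.injective (Subtype.ext h)
      z_surj := fun v hv => ⟨eI.symm ⟨v, hv⟩, by simp⟩
      x_surj := fun v hv => ⟨eJ.symm ⟨v, hv⟩, by simp⟩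
      M_dist := fun i a => (eN (eI i).1 a).2.1
      M_adj := fun i a => (eN (eI i).1 a).2.2
      M_inj := fun i a a' h => (eN (eI i).1).injective (Subtype.ext h)
      M_surj := fun i v h1 h2 => ⟨(eN (eI i).1).symm ⟨v, h1, h2⟩, by simp⟩
      T_zero := fun i => (hcT i).1
      T_below := fun i t ht => ((hcT i).2.1 t (by omega)).1
      T_dist := fun i t ht => by
        obtain ⟨h1, h2⟩ := (hcT i).2.1 t (by omega)
        rw [← h1, h2, (eI i).2.1, add_comm]
      T_surj := fun i v hv => by
        simpa only [Nat.lt_succ_iff] using (hcT i).2.2.1 v hv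
      T_adj := fun i t ht => (hcT i).2.2.2 t (by omega)
      L_zero := fun j => (hcL j).1
      L_below := fun j t ht => ((hcL j).2.1 t (by omega)).1
      L_dist := fun j t ht => by
        obtain ⟨h1, h2⟩ := (hcL j).2.1 t (by omega)
        rw [← h1, h2, (eJ j).2.1, add_comm]
      L_surj := fun j v hv => by
        simpa only [Nat.lt_succ_iff] using (hcL j).2.2.1 v hv
      L_adj := fun j t ht => (hcL j).2.2.2 t (by omega) }

end Structure

/-- A connected graph with at least two vertices satisfies `gpg'(G) = 2` iff `G ∈ 𝓗`. -/
theorem stmt_11 {V : Type*} [Fintype V] (G : SimpleGraph V) (hG : G.Connected)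
    (h2 : 2 ≤ Fintype.card V) :
    gpg' G = 2 ↔ InH G := by
  rw [gpg'_eq_two_iff hG h2]
  refine ⟨fun ⟨u, hu⟩ => ?_, fun h => h.exists_collinear3 hG⟩
  exact IsHub.inH hG (u := u) fun v w hvw hl => dist_of_dist_eq hG hu hvw hl
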